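/- For every k ∈ {11, 12} ∪ {14, 15, ..., 26} there exists a 2-semiarc of size k in PG(2,11), and for every k ∈ {13} ∪ {27, 28, 29, 30} there exists a 2-semiarc of size k in PG(2,13). -/

import Mathlib

noncomputable section

/-- Points of `PG(2,F)`: the projectivization of `F³`. -/
abbrev PGPoint (F : Type*) [Field F] := Projectivization F (Fin 3 → F)

/-- Lines of `PG(2,F)`: the 2-dimensional linear subspaces of `F³`. -/
abbrev PGLine (F : Type*) [Field F] :=
  {W : Submodule F (Fin 3 → F) // Module.finrank F W = 2}

/-- A point lies on a line when its representative vectors belong to the subspace. -/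
def PGMem {F : Type*} [Field F] (p : PGPoint F) (ℓ : PGLine F) : Prop :=
  p.submodule ≤ ℓ.1

/-- A line `ℓ` is a tangent to `S` at `p` if `S ∩ ℓ = {p}`. -/
def PGTangent {F : Type*} [Field F] (S : Set (PGPoint F)) (ℓ : PGLine F) (p : PGPoint F) :
    Prop :=
  S ∩ {x | PGMem x ℓ} = {p}

/-- A 2-semiarc in `PG(2,F)`: a nonempty set of points such that through each of its points
there pass exactly 2 tangent lines. -/
def IsTwoSemiarc {F : Type*} [Field F] (S : Set (PGPoint F)) : Prop :=
  S.Nonempty ∧ ∀ p ∈ S, {ℓ : PGLine F | PGTangent S ℓ p}.ncard = 2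
instance : Fact (Nat.Prime 11) := ⟨by norm_num⟩
instance : Fact (Nat.Prime 13) := ⟨by norm_num⟩

/-- Coordinate triples, as natural numbers (to be read modulo `q`). -/
abbrev Triple := ℕ × ℕ × ℕ

/-- The vector over `ZMod q` of a coordinate triple. -/
def vec (q : ℕ) (t : Triple) : Fin 3 → ZMod q := ![(t.1 : ZMod q), (t.2.1 : ZMod q), (t.2.2 : ZMod q)]

/-- Incidence of a point and a line given by homogeneous coordinates. -/
def inc (q : ℕ) (w t : Triple) : Bool :=
  Nat.beq ((w.1 * t.1 + w.2.1 * t.2.1 + w.2.2 * t.2.2) % q) 0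

/-- All normalized triples: the first nonzero coordinate is `1`. -/
def allTriples (q : ℕ) : List Triple :=
  (0, 0, 1) :: ((List.range q).map (fun b => (0, 1, b)) ++
    (List.range q).flatMap (fun a => (List.range q).map (fun b => (1, a, b))))

/-- Normalized vectors: the first nonzero coordinate is `1`. -/
def NormV {F : Type*} [Field F] (v : Fin 3 → F) : Prop :=
  v 0 = 1 ∨ (v 0 = 0 ∧ v 1 = 1) ∨ (v 0 = 0 ∧ v 1 = 0 ∧ v 2 = 1)

theorem NormV.ne_zero {F : Type*} [Field F] {v : Fin 3 → F} (h : NormV v) : v ≠ 0 := by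
  rintro rfl
  simp [NormV] at h

theorem NormV.eq_of_cross {F : Type*} [Field F] {v w : Fin 3 → F} (hv : NormV v) (hw : NormV w)
    (h01 : v 0 * w 1 = v 1 * w 0) (h02 : v 0 * w 2 = v 2 * w 0) (h12 : v 1 * w 2 = v 2 * w 1) :
    v = w := by
  have key : v 0 = w 0 ∧ v 1 = w 1 ∧ v 2 = w 2 := by
    rcases hv with a | ⟨a, b⟩ | ⟨a, b, c⟩ <;> rcases hw with d | ⟨d, e⟩ | ⟨d, e, f⟩ <;>
      simp_all
  funext i
  fin_cases i
  · exact key.1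
  · exact key.2.1
  · exact key.2.2

theorem exists_normV {F : Type*} [Field F] (v : Fin 3 → F) (hv : v ≠ 0) :
    ∃ c : F, c ≠ 0 ∧ NormV (c • v) := by
  by_cases h0 : v 0 = 0
  · by_cases h1 : v 1 = 0
    · have h2 : v 2 ≠ 0 := by
        intro h2
        apply hv
        funext i
        fin_cases i
        · exact h0
        · exact h1
        · exact h2
      exact ⟨(v 2)⁻¹, inv_ne_zero h2, Or.inr (Or.inr (by simp [h0, h1, h2]))⟩
    · exact ⟨(v 1)⁻¹, inv_ne_zero h1, Or.inr (Or.inl (by simp [h0, h1]))⟩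
  · exact ⟨(v 0)⁻¹, inv_ne_zero h0, Or.inl (by simp [h0])⟩

set_option linter.unusedSectionVars false

section
variable (q : ℕ) [Fact q.Prime]

theorem inc_iff (w t : Triple) : inc q w t = true ↔ vec q w ⬝ᵥ vec q t = 0 := by
  have : vec q w ⬝ᵥ vec q t = ((w.1 * t.1 + w.2.1 * t.2.1 + w.2.2 * t.2.2 : ℕ) : ZMod q) := by
    simp [vec, dotProduct, Fin.sum_univ_three]
  rw [this, ZMod.natCast_eq_zero_iff, inc, Nat.beq_eq, Nat.dvd_iff_mod_eq_zero]

theorem mem_allTriples (t : Triple) : t ∈ allTriples q ↔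
    t = (0, 0, 1) ∨ (∃ b < q, t = (0, 1, b)) ∨ (∃ a < q, ∃ b < q, t = (1, a, b)) := by
  simp [allTriples, eq_comm]

theorem norm_of_mem {t : Triple} (h : t ∈ allTriples q) : NormV (vec q t) := by
  rw [mem_allTriples] at h
  rcases h with rfl | ⟨b, hb, rfl⟩ | ⟨a, ha, b, hb, rfl⟩ <;> simp [NormV, vec]

theorem lt_of_mem {t : Triple} (h : t ∈ allTriples q) : t.1 < q ∧ t.2.1 < q ∧ t.2.2 < q := by
  have hq : 1 < q := (Fact.out : q.Prime).one_lt
  rw [mem_allTriples] at h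
  rcases h with rfl | ⟨b, hb, rfl⟩ | ⟨a, ha, b, hb, rfl⟩ <;> simp <;> omega

theorem vec_inj {t u : Triple} (ht : t ∈ allTriples q) (hu : u ∈ allTriples q)
    (h : vec q t = vec q u) : t = u := by
  obtain ⟨a, b, c⟩ := lt_of_mem q ht
  obtain ⟨a', b', c'⟩ := lt_of_mem q hu
  have e : ∀ x y : ℕ, x < q → y < q → (x : ZMod q) = y → x = y := by
    intro x y hx hy hxy
    rw [ZMod.natCast_eq_natCast_iff] at hxy
    exact Nat.ModEq.eq_of_lt_of_lt hxy hx hy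
  have h0 := congrFun h 0
  have h1 := congrFun h 1
  have h2 := congrFun h 2
  simp only [vec, Matrix.cons_val] at h0 h1 h2
  exact Prod.ext (e _ _ a a' h0) (Prod.ext (e _ _ b b' h1) (e _ _ c c' h2))

theorem exists_triple (v : Fin 3 → ZMod q) (hv : NormV v) : ∃ t ∈ allTriples q, vec q t = v := by
  have hlt : ∀ x : ZMod q, x.val < q := fun x => ZMod.val_lt x
  have key : ∀ t : Triple, (t.1 : ZMod q) = v 0 → (t.2.1 : ZMod q) = v 1 →
      (t.2.2 : ZMod q) = v 2 → vec q t = v := by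
    intro t h0 h1 h2
    funext i
    fin_cases i
    · exact h0
    · exact h1
    · exact h2
  rcases hv with a | ⟨a, b⟩ | ⟨a, b, c⟩
  · refine ⟨(1, (v 1).val, (v 2).val), ?_, key _ ?_ ?_ ?_⟩
    · rw [mem_allTriples]
      exact Or.inr (Or.inr ⟨_, hlt _, _, hlt _, rfl⟩)
    all_goals simp [a]
  · refine ⟨(0, 1, (v 2).val), ?_, key _ ?_ ?_ ?_⟩
    · rw [mem_allTriples]
      exact Or.inr (Or.inl ⟨_, hlt _, rfl⟩)
    all_goals simp [a, b]
  · refine ⟨(0, 0, 1), ?_, key _ ?_ ?_ ?_⟩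
    · rw [mem_allTriples]
      exact Or.inl rfl
    all_goals simp [a, b, c]

/-- The linear functional `v ↦ w ⬝ v`. -/
def fnl (w : Fin 3 → ZMod q) : (Fin 3 → ZMod q) →ₗ[ZMod q] ZMod q :=
  dotProductBilin (ZMod q) (ZMod q) w

theorem fnl_apply (w v : Fin 3 → ZMod q) : fnl q w v = w ⬝ᵥ v := rfl

theorem fnl_ne_zero {w : Fin 3 → ZMod q} (hw : w ≠ 0) : fnl q w ≠ 0 := by
  intro h
  apply hw
  funext i
  have := LinearMap.congr_fun h (Pi.single i 1)
  simpa [fnl_apply] using this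

theorem finrank_ker_fun {f : (Fin 3 → ZMod q) →ₗ[ZMod q] ZMod q} (hf : f ≠ 0) :
    Module.finrank (ZMod q) (LinearMap.ker f) = 2 := by
  have h1 := LinearMap.finrank_range_add_finrank_ker f
  have h2 : LinearMap.range f = ⊤ := LinearMap.range_eq_top.2 (LinearMap.surjective hf)
  rw [h2, finrank_top] at h1
  simp at h1
  omega

theorem exists_fun (W : PGLine (ZMod q)) :
    ∃ t ∈ allTriples q, W.1 = LinearMap.ker (fnl q (vec q t)) := by
  obtain ⟨W, hW⟩ := W
  have hlt : W < ⊤ := by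
    rw [lt_top_iff_ne_top]
    rintro rfl
    simp at hW
  obtain ⟨f, hf, hle⟩ := Submodule.exists_le_ker_of_lt_top W hlt
  have hWf : W = LinearMap.ker f :=
    Submodule.eq_of_le_of_finrank_eq hle (by rw [hW, finrank_ker_fun q hf])
  set w : Fin 3 → ZMod q := fun i => f (Pi.single i 1) with hw
  have hfw : ∀ v, f v = w ⬝ᵥ v := by
    intro v
    conv_lhs => rw [LinearMap.pi_apply_eq_sum_univ f v]
    simp only [dotProduct, hw, smul_eq_mul]
    refine Finset.sum_congr rfl fun i _ => ?_
    rw [mul_comm]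
    congr 2
    funext j
    simp [Pi.single_apply, eq_comm]
  have hw0 : w ≠ 0 := by
    intro h0
    apply hf
    ext1 v
    simp [h0] at hfw
    ext
    simp [hfw]
  obtain ⟨c, hc, hn⟩ := exists_normV w hw0
  obtain ⟨t, ht, hv⟩ := exists_triple q _ hn
  refine ⟨t, ht, ?_⟩
  ext v
  change v ∈ W ↔ _
  rw [hWf, LinearMap.mem_ker, LinearMap.mem_ker, fnl_apply, hv, hfw, smul_dotProduct, smul_eq_mul]
  simp [hc]

/-- The line with given coordinates. -/
def ln (w : Triple) (hw : w ∈ allTriples q) : PGLine (ZMod q) :=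
  ⟨LinearMap.ker (fnl q (vec q w)), finrank_ker_fun q (fnl_ne_zero q (norm_of_mem q hw).ne_zero)⟩

theorem ln_inj (w u : Triple) (hw : w ∈ allTriples q) (hu : u ∈ allTriples q)
    (h : ln q w hw = ln q u hu) : w = u := by
  apply vec_inj q hw hu
  have h' : ∀ v, vec q w ⬝ᵥ v = 0 → vec q u ⬝ᵥ v = 0 := by
    intro v hv
    have h2 := congrArg Subtype.val h
    have : v ∈ LinearMap.ker (fnl q (vec q w)) := hv
    have h3 : v ∈ LinearMap.ker (fnl q (vec q u)) := by
      have h4 : LinearMap.ker (fnl q (vec q w)) = LinearMap.ker (fnl q (vec q u)) := h2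
      rwa [h4] at this
    exact h3
  have hx := norm_of_mem q hw
  generalize vec q w = x at h' hx ⊢
  have a := h' ![- x 1, x 0, 0] (by simp [dotProduct, Fin.sum_univ_three]; ring)
  have b := h' ![- x 2, 0, x 0] (by simp [dotProduct, Fin.sum_univ_three]; ring)
  have c := h' ![0, - x 2, x 1] (by simp [dotProduct, Fin.sum_univ_three]; ring)
  simp [dotProduct, Fin.sum_univ_three] at a b c
  refine NormV.eq_of_cross hx (norm_of_mem q hu) ?_ ?_ ?_
  · linear_combination a
  · linear_combination b
  · linear_combination c

/-- The point with given coordinates. -/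
def pt (t : Triple) (ht : t ∈ allTriples q) : PGPoint (ZMod q) :=
  Projectivization.mk (ZMod q) (vec q t) (norm_of_mem q ht).ne_zero

theorem pt_inj (t u : Triple) (ht : t ∈ allTriples q) (hu : u ∈ allTriples q)
    (h : pt q t ht = pt q u hu) : t = u := by
  apply vec_inj q ht hu
  rw [pt, pt, Projectivization.mk_eq_mk_iff'] at h
  obtain ⟨a, ha⟩ := h
  refine NormV.eq_of_cross (norm_of_mem q ht) (norm_of_mem q hu) ?_ ?_ ?_ <;>
  · rw [← ha]
    simp only [Pi.smul_apply, smul_eq_mul]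
    ring

theorem mem_iff (t w : Triple) (ht : t ∈ allTriples q) (hw : w ∈ allTriples q) :
    PGMem (pt q t ht) (ln q w hw) ↔ inc q w t = true := by
  rw [inc_iff, PGMem, pt, Projectivization.submodule_mk, Submodule.span_singleton_le_iff_mem]
  rfl

/-- The points of `L` on each line of the plane. -/
def sections (L : List Triple) : List (List Triple) :=
  (allTriples q).map fun w => L.filter (inc q w)

/-- The computational check. -/
def check (L : List Triple) : Bool :=
  L.all fun t => Nat.beq ((sections q L).countP (fun l => l == [t])) 2

theorem exists_of_check (L : List Triple) (h0 : L ≠ [] ∧ L.Nodup ∧ ∀ t ∈ L, t ∈ allTriples q)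
    (hnd : (allTriples q).Nodup) (hc : check q L = true) :
    ∃ S : Set (PGPoint (ZMod q)), IsTwoSemiarc S ∧ S.ncard = L.length := by
  obtain ⟨hne, hL, hmem⟩ := h0
  refine ⟨{x | ∃ t, ∃ h : t ∈ L, x = pt q t (hmem t h)}, ⟨?_, ?_⟩, ?_⟩
  · obtain ⟨t, ht⟩ := List.exists_mem_of_ne_nil L hne
    exact ⟨_, t, ht, rfl⟩
  · rintro p ⟨t, ht, rfl⟩
    have h2 : ((allTriples q).filter (fun w => L.filter (inc q w) == [t])).length = 2 := by
      have := List.all_eq_true.1 hc t ht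
      rw [Nat.beq_eq, sections, List.countP_map, List.countP_eq_length_filter] at this
      exact this
    have h3 : ((allTriples q).filter (fun w => L.filter (inc q w) == [t])).toFinset.card = 2 := by
      rw [List.toFinset_card_of_nodup (hnd.filter _), h2]
    rw [← h3, ← Set.ncard_coe_finset]
    have hfil : ∀ w, L.filter (inc q w) = [t] ↔ ∀ u ∈ L, (inc q w u = true ↔ u = t) := by
      intro w
      constructor
      · intro h u hu
        have : u ∈ L.filter (inc q w) ↔ u ∈ [t] := by rw [h]
        simpa [hu] using this
      · intro h
        have : L.filter (inc q w) = L.filter (fun u => u == t) := by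
          apply List.filter_congr
          intro u hu
          rw [Bool.eq_iff_iff, h u hu]
          simp
        rw [this, List.filter_beq, List.count_eq_one_of_mem hL ht]
        rfl
    have htan : ∀ w (hw : w ∈ allTriples q),
        PGTangent {x | ∃ t, ∃ h : t ∈ L, x = pt q t (hmem t h)} (ln q w hw)
          (pt q t (hmem t ht)) ↔ L.filter (inc q w) = [t] := by
      intro w hw
      rw [hfil, PGTangent, Set.ext_iff]
      constructor
      · intro h u hu
        have h4 := h (pt q u (hmem u hu))
        rw [← mem_iff q u w (hmem u hu) hw]
        constructor
        · intro h5
          exact pt_inj q _ _ _ _ (h4.1 ⟨⟨u, hu, rfl⟩, h5⟩)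
        · rintro rfl
          exact (h4.2 rfl).2
      · intro h x
        constructor
        · rintro ⟨⟨u, hu, rfl⟩, hx⟩
          have hx' := (mem_iff q u w (hmem u hu) hw).1 hx
          have := (h u hu).1 hx'
          subst this
          rfl
        · rintro rfl
          exact ⟨⟨t, ht, rfl⟩, (mem_iff q t w (hmem t ht) hw).2 ((h t ht).2 rfl)⟩
    symm
    refine Set.ncard_congr (fun w hw => ln q w (by simp at hw; exact hw.1)) ?_ ?_ ?_
    · intro w hw
      simp at hw
      exact (htan w hw.1).2 hw.2
    · intro w u hw hu h
      exact ln_inj q _ _ _ _ h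
    · intro W hW
      obtain ⟨w, hw, e⟩ := exists_fun q W
      have e' : ln q w hw = W := Subtype.ext e.symm
      refine ⟨w, ?_, e'⟩
      have hW' : PGTangent _ _ _ := hW
      rw [← e'] at hW'
      have := (htan w hw).1 hW'
      simp [hw, this]
  · rw [← List.toFinset_card_of_nodup hL, ← Set.ncard_coe_finset]
    symm
    refine Set.ncard_congr (fun t ht => pt q t (hmem t (by simpa using ht))) ?_ ?_ ?_
    · intro t ht
      exact ⟨t, by simpa using ht, rfl⟩
    · intro t u _ _ h
      exact pt_inj q _ _ _ _ h
    · rintro x ⟨t, ht, rfl⟩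
      exact ⟨t, by simpa using ht, rfl⟩

end

theorem all_nodup_11 : (allTriples 11).Nodup := by decide +kernel

theorem all_nodup_13 : (allTriples 13).Nodup := by decide +kernel


/-- The homogeneous coordinates of a 2-semiarc with 11 points in `PG(2,11)`. -/
def arc_11_11 : List Triple :=
  [ (1, 1, 2), (1, 2, 1), (1, 2, 2), (1, 4, 3), (1, 4, 6), (1, 6, 6), (1, 6, 9), (1, 8, 0),
    (1, 8, 10), (1, 9, 3), (1, 9, 10) ]

theorem exists_11_11 : ∃ S : Set (PGPoint (ZMod 11)), IsTwoSemiarc S ∧ S.ncard = 11 :=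
  exists_of_check 11 arc_11_11 (by decide +kernel) all_nodup_11 (by decide +kernel)

/-- The homogeneous coordinates of a 2-semiarc with 12 points in `PG(2,11)`. -/
def arc_11_12 : List Triple :=
  [ (0, 1, 5), (0, 1, 8), (1, 3, 7), (1, 3, 9), (1, 5, 7), (1, 6, 8), (1, 6, 10), (1, 7, 3),
    (1, 7, 10), (1, 8, 3), (1, 8, 6), (1, 10, 6) ]

theorem exists_11_12 : ∃ S : Set (PGPoint (ZMod 11)), IsTwoSemiarc S ∧ S.ncard = 12 :=
  exists_of_check 11 arc_11_12 (by decide +kernel) all_nodup_11 (by decide +kernel)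

/-- The homogeneous coordinates of a 2-semiarc with 14 points in `PG(2,11)`. -/
def arc_11_14 : List Triple :=
  [ (0, 1, 2), (1, 0, 1), (1, 0, 6), (1, 2, 8), (1, 2, 10), (1, 3, 3), (1, 3, 5), (1, 5, 9),
    (1, 6, 8), (1, 7, 1), (1, 7, 3), (1, 7, 5), (1, 8, 9), (1, 8, 10) ]

theorem exists_11_14 : ∃ S : Set (PGPoint (ZMod 11)), IsTwoSemiarc S ∧ S.ncard = 14 :=
  exists_of_check 11 arc_11_14 (by decide +kernel) all_nodup_11 (by decide +kernel)

/-- The homogeneous coordinates of a 2-semiarc with 15 points in `PG(2,11)`. -/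
def arc_11_15 : List Triple :=
  [ (1, 0, 3), (1, 1, 2), (1, 1, 4), (1, 3, 5), (1, 4, 2), (1, 5, 1), (1, 5, 2), (1, 5, 7),
    (1, 7, 1), (1, 7, 8), (1, 8, 4), (1, 8, 5), (1, 8, 9), (1, 10, 8), (1, 10, 9) ]

theorem exists_11_15 : ∃ S : Set (PGPoint (ZMod 11)), IsTwoSemiarc S ∧ S.ncard = 15 :=
  exists_of_check 11 arc_11_15 (by decide +kernel) all_nodup_11 (by decide +kernel)

/-- The homogeneous coordinates of a 2-semiarc with 16 points in `PG(2,11)`. -/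
def arc_11_16 : List Triple :=
  [ (1, 0, 1), (1, 0, 2), (1, 0, 7), (1, 1, 0), (1, 1, 5), (1, 1, 7), (1, 3, 10), (1, 4, 0),
    (1, 4, 8), (1, 4, 10), (1, 5, 3), (1, 6, 4), (1, 6, 8), (1, 8, 7), (1, 8, 10), (1, 9, 8) ]

theorem exists_11_16 : ∃ S : Set (PGPoint (ZMod 11)), IsTwoSemiarc S ∧ S.ncard = 16 :=
  exists_of_check 11 arc_11_16 (by decide +kernel) all_nodup_11 (by decide +kernel)

/-- The homogeneous coordinates of a 2-semiarc with 17 points in `PG(2,11)`. -/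
def arc_11_17 : List Triple :=
  [ (1, 0, 9), (1, 1, 1), (1, 1, 7), (1, 1, 9), (1, 1, 10), (1, 2, 4), (1, 2, 8), (1, 3, 8),
    (1, 4, 4), (1, 4, 5), (1, 5, 1), (1, 7, 1), (1, 7, 3), (1, 9, 8), (1, 9, 10), (1, 10, 1),
    (1, 10, 3) ]

theorem exists_11_17 : ∃ S : Set (PGPoint (ZMod 11)), IsTwoSemiarc S ∧ S.ncard = 17 :=
  exists_of_check 11 arc_11_17 (by decide +kernel) all_nodup_11 (by decide +kernel)

/-- The homogeneous coordinates of a 2-semiarc with 18 points in `PG(2,11)`. -/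
def arc_11_18 : List Triple :=
  [ (0, 1, 2), (0, 1, 8), (1, 0, 1), (1, 1, 4), (1, 1, 6), (1, 3, 1), (1, 3, 9), (1, 4, 7),
    (1, 5, 1), (1, 6, 5), (1, 6, 10), (1, 7, 8), (1, 7, 9), (1, 8, 0), (1, 8, 2), (1, 8, 10),
    (1, 9, 5), (1, 10, 7) ]

theorem exists_11_18 : ∃ S : Set (PGPoint (ZMod 11)), IsTwoSemiarc S ∧ S.ncard = 18 :=
  exists_of_check 11 arc_11_18 (by decide +kernel) all_nodup_11 (by decide +kernel)

/-- The homogeneous coordinates of a 2-semiarc with 19 points in `PG(2,11)`. -/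
def arc_11_19 : List Triple :=
  [ (1, 0, 6), (1, 0, 10), (1, 1, 4), (1, 2, 5), (1, 3, 10), (1, 4, 2), (1, 4, 3), (1, 4, 9),
    (1, 5, 1), (1, 5, 10), (1, 6, 1), (1, 7, 0), (1, 7, 1), (1, 8, 1), (1, 8, 4), (1, 8, 7),
    (1, 9, 7), (1, 10, 5), (1, 10, 7) ]

theorem exists_11_19 : ∃ S : Set (PGPoint (ZMod 11)), IsTwoSemiarc S ∧ S.ncard = 19 :=
  exists_of_check 11 arc_11_19 (by decide +kernel) all_nodup_11 (by decide +kernel)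

/-- The homogeneous coordinates of a 2-semiarc with 20 points in `PG(2,11)`. -/
def arc_11_20 : List Triple :=
  [ (0, 1, 6), (1, 0, 1), (1, 1, 0), (1, 1, 7), (1, 2, 1), (1, 2, 3), (1, 2, 5), (1, 2, 10),
    (1, 4, 0), (1, 4, 3), (1, 4, 4), (1, 4, 5), (1, 5, 3), (1, 5, 5), (1, 5, 10), (1, 6, 3),
    (1, 7, 5), (1, 8, 0), (1, 9, 6), (1, 10, 5) ]

theorem exists_11_20 : ∃ S : Set (PGPoint (ZMod 11)), IsTwoSemiarc S ∧ S.ncard = 20 :=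
  exists_of_check 11 arc_11_20 (by decide +kernel) all_nodup_11 (by decide +kernel)

/-- The homogeneous coordinates of a 2-semiarc with 21 points in `PG(2,11)`. -/
def arc_11_21 : List Triple :=
  [ (0, 1, 9), (1, 0, 2), (1, 0, 6), (1, 1, 4), (1, 1, 8), (1, 1, 10), (1, 2, 1), (1, 2, 2),
    (1, 2, 6), (1, 2, 10), (1, 3, 9), (1, 4, 1), (1, 4, 8), (1, 6, 2), (1, 8, 7), (1, 8, 8),
    (1, 9, 1), (1, 9, 3), (1, 9, 4), (1, 10, 5), (1, 10, 6) ]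

theorem exists_11_21 : ∃ S : Set (PGPoint (ZMod 11)), IsTwoSemiarc S ∧ S.ncard = 21 :=
  exists_of_check 11 arc_11_21 (by decide +kernel) all_nodup_11 (by decide +kernel)

/-- The homogeneous coordinates of a 2-semiarc with 22 points in `PG(2,11)`. -/
def arc_11_22 : List Triple :=
  [ (0, 1, 0), (0, 1, 6), (1, 0, 8), (1, 0, 10), (1, 1, 5), (1, 1, 8), (1, 2, 9), (1, 2, 10),
    (1, 4, 1), (1, 4, 8), (1, 5, 5), (1, 5, 10), (1, 6, 3), (1, 6, 7), (1, 7, 1), (1, 7, 4),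
    (1, 7, 8), (1, 8, 0), (1, 8, 1), (1, 8, 10), (1, 10, 4), (1, 10, 8) ]

theorem exists_11_22 : ∃ S : Set (PGPoint (ZMod 11)), IsTwoSemiarc S ∧ S.ncard = 22 :=
  exists_of_check 11 arc_11_22 (by decide +kernel) all_nodup_11 (by decide +kernel)

/-- The homogeneous coordinates of a 2-semiarc with 23 points in `PG(2,11)`. -/
def arc_11_23 : List Triple :=
  [ (0, 1, 5), (0, 1, 8), (0, 1, 9), (1, 0, 1), (1, 0, 3), (1, 0, 6), (1, 0, 8), (1, 1, 8),
    (1, 1, 9), (1, 2, 0), (1, 4, 0), (1, 4, 2), (1, 4, 7), (1, 5, 3), (1, 6, 4), (1, 7, 3),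
    (1, 8, 0), (1, 8, 5), (1, 8, 7), (1, 8, 8), (1, 8, 10), (1, 9, 3), (1, 10, 10) ]

theorem exists_11_23 : ∃ S : Set (PGPoint (ZMod 11)), IsTwoSemiarc S ∧ S.ncard = 23 :=
  exists_of_check 11 arc_11_23 (by decide +kernel) all_nodup_11 (by decide +kernel)

/-- The homogeneous coordinates of a 2-semiarc with 24 points in `PG(2,11)`. -/
def arc_11_24 : List Triple :=
  [ (0, 1, 4), (1, 0, 0), (1, 1, 3), (1, 1, 10), (1, 2, 4), (1, 2, 5), (1, 2, 8), (1, 3, 2),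
    (1, 3, 5), (1, 4, 4), (1, 4, 6), (1, 4, 9), (1, 6, 1), (1, 6, 2), (1, 6, 4), (1, 7, 4),
    (1, 8, 2), (1, 9, 0), (1, 9, 3), (1, 9, 4), (1, 9, 5), (1, 9, 7), (1, 10, 0), (1, 10, 3) ]

theorem exists_11_24 : ∃ S : Set (PGPoint (ZMod 11)), IsTwoSemiarc S ∧ S.ncard = 24 :=
  exists_of_check 11 arc_11_24 (by decide +kernel) all_nodup_11 (by decide +kernel)

/-- The homogeneous coordinates of a 2-semiarc with 25 points in `PG(2,11)`. -/
def arc_11_25 : List Triple :=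
  [ (0, 1, 0), (0, 1, 3), (0, 1, 4), (1, 0, 0), (1, 1, 0), (1, 2, 4), (1, 2, 10), (1, 3, 2),
    (1, 3, 3), (1, 3, 4), (1, 3, 8), (1, 4, 10), (1, 5, 3), (1, 5, 6), (1, 5, 8), (1, 5, 9),
    (1, 6, 2), (1, 6, 5), (1, 7, 4), (1, 8, 2), (1, 9, 3), (1, 9, 5), (1, 9, 8), (1, 9, 10),
    (1, 10, 5) ]

theorem exists_11_25 : ∃ S : Set (PGPoint (ZMod 11)), IsTwoSemiarc S ∧ S.ncard = 25 :=
  exists_of_check 11 arc_11_25 (by decide +kernel) all_nodup_11 (by decide +kernel)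

/-- The homogeneous coordinates of a 2-semiarc with 26 points in `PG(2,11)`. -/
def arc_11_26 : List Triple :=
  [ (0, 1, 0), (1, 0, 7), (1, 0, 10), (1, 1, 9), (1, 2, 0), (1, 3, 6), (1, 4, 2), (1, 4, 5),
    (1, 5, 0), (1, 5, 3), (1, 5, 4), (1, 5, 5), (1, 5, 9), (1, 6, 0), (1, 6, 2), (1, 6, 10),
    (1, 7, 3), (1, 7, 6), (1, 8, 0), (1, 8, 6), (1, 8, 7), (1, 9, 3), (1, 9, 7), (1, 10, 1),
    (1, 10, 3), (1, 10, 4) ]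

theorem exists_11_26 : ∃ S : Set (PGPoint (ZMod 11)), IsTwoSemiarc S ∧ S.ncard = 26 :=
  exists_of_check 11 arc_11_26 (by decide +kernel) all_nodup_11 (by decide +kernel)

/-- The homogeneous coordinates of a 2-semiarc with 13 points in `PG(2,13)`. -/
def arc_13_13 : List Triple :=
  [ (0, 1, 12), (1, 1, 6), (1, 1, 9), (1, 2, 0), (1, 2, 7), (1, 5, 0), (1, 5, 9), (1, 7, 1),
    (1, 7, 5), (1, 10, 1), (1, 10, 7), (1, 11, 5), (1, 11, 8) ]

theorem exists_13_13 : ∃ S : Set (PGPoint (ZMod 13)), IsTwoSemiarc S ∧ S.ncard = 13 :=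
  exists_of_check 13 arc_13_13 (by decide +kernel) all_nodup_13 (by decide +kernel)

/-- The homogeneous coordinates of a 2-semiarc with 27 points in `PG(2,13)`. -/
def arc_13_27 : List Triple :=
  [ (0, 1, 0), (0, 1, 10), (1, 0, 0), (1, 0, 10), (1, 1, 6), (1, 1, 10), (1, 2, 0), (1, 3, 10),
    (1, 4, 1), (1, 4, 4), (1, 4, 7), (1, 4, 10), (1, 4, 12), (1, 5, 3), (1, 5, 7), (1, 5, 10),
    (1, 6, 11), (1, 7, 7), (1, 7, 8), (1, 7, 11), (1, 9, 1), (1, 9, 8), (1, 9, 12), (1, 10, 0),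
    (1, 10, 8), (1, 10, 9), (1, 12, 4) ]

theorem exists_13_27 : ∃ S : Set (PGPoint (ZMod 13)), IsTwoSemiarc S ∧ S.ncard = 27 :=
  exists_of_check 13 arc_13_27 (by decide +kernel) all_nodup_13 (by decide +kernel)

/-- The homogeneous coordinates of a 2-semiarc with 28 points in `PG(2,13)`. -/
def arc_13_28 : List Triple :=
  [ (0, 1, 4), (1, 1, 0), (1, 1, 4), (1, 1, 10), (1, 1, 11), (1, 2, 1), (1, 2, 9), (1, 3, 9),
    (1, 4, 6), (1, 4, 10), (1, 5, 0), (1, 5, 5), (1, 5, 6), (1, 6, 11), (1, 7, 10), (1, 8, 4),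
    (1, 9, 0), (1, 9, 3), (1, 9, 4), (1, 10, 0), (1, 10, 9), (1, 11, 6), (1, 11, 7), (1, 11, 9),
    (1, 11, 12), (1, 12, 5), (1, 12, 9), (1, 12, 10) ]

theorem exists_13_28 : ∃ S : Set (PGPoint (ZMod 13)), IsTwoSemiarc S ∧ S.ncard = 28 :=
  exists_of_check 13 arc_13_28 (by decide +kernel) all_nodup_13 (by decide +kernel)

/-- The homogeneous coordinates of a 2-semiarc with 29 points in `PG(2,13)`. -/
def arc_13_29 : List Triple :=
  [ (0, 1, 2), (0, 1, 3), (0, 1, 7), (1, 0, 2), (1, 0, 3), (1, 0, 6), (1, 0, 7), (1, 0, 8),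
    (1, 0, 9), (1, 1, 1), (1, 1, 10), (1, 2, 9), (1, 3, 7), (1, 4, 7), (1, 5, 0), (1, 5, 7),
    (1, 5, 10), (1, 6, 5), (1, 7, 1), (1, 7, 6), (1, 7, 8), (1, 8, 2), (1, 9, 2), (1, 9, 5),
    (1, 10, 10), (1, 11, 10), (1, 12, 4), (1, 12, 8), (1, 12, 12) ]

theorem exists_13_29 : ∃ S : Set (PGPoint (ZMod 13)), IsTwoSemiarc S ∧ S.ncard = 29 :=
  exists_of_check 13 arc_13_29 (by decide +kernel) all_nodup_13 (by decide +kernel)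

/-- The homogeneous coordinates of a 2-semiarc with 30 points in `PG(2,13)`. -/
def arc_13_30 : List Triple :=
  [ (0, 1, 0), (1, 0, 2), (1, 0, 11), (1, 1, 7), (1, 1, 10), (1, 2, 6), (1, 2, 8), (1, 3, 2),
    (1, 3, 7), (1, 3, 11), (1, 3, 12), (1, 4, 1), (1, 4, 5), (1, 4, 10), (1, 4, 12), (1, 5, 3),
    (1, 7, 4), (1, 7, 11), (1, 8, 1), (1, 8, 10), (1, 8, 11), (1, 9, 3), (1, 10, 2), (1, 10, 10),
    (1, 11, 7), (1, 11, 8), (1, 12, 1), (1, 12, 5), (1, 12, 7), (1, 12, 9) ]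

theorem exists_13_30 : ∃ S : Set (PGPoint (ZMod 13)), IsTwoSemiarc S ∧ S.ncard = 30 :=
  exists_of_check 13 arc_13_30 (by decide +kernel) all_nodup_13 (by decide +kernel)

/-- In `PG(2,11)` there exist 2-semiarcs of every size `k ∈ {11, 12} ∪ {14, …, 26}`, and
in `PG(2,13)` there exist 2-semiarcs of every size `k ∈ {13} ∪ {27, …, 30}`. -/
theorem two_semiarc_PG2_11_13_spectrum :
    (∀ k : ℕ, k ∈ ({11, 12} : Set ℕ) ∪ Set.Icc 14 26 →
      ∃ S : Set (PGPoint (ZMod 11)), IsTwoSemiarc S ∧ S.ncard = k) ∧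
    (∀ k : ℕ, k ∈ ({13} : Set ℕ) ∪ Set.Icc 27 30 →
      ∃ S : Set (PGPoint (ZMod 13)), IsTwoSemiarc S ∧ S.ncard = k) := by
  constructor
  · intro k hk
    have hk' : k = 11 ∨ k = 12 ∨ (14 ≤ k ∧ k ≤ 26) := by
      simpa [or_assoc] using hk
    have h2 : 11 ≤ k ∧ k ≤ 26 ∧ k ≠ 13 := by omega
    obtain ⟨h3, h4, h5⟩ := h2
    interval_cases k
    · exact exists_11_11
    · exact exists_11_12
    · exact absurd rfl h5
    · exact exists_11_14
    · exact exists_11_15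
    · exact exists_11_16
    · exact exists_11_17
    · exact exists_11_18
    · exact exists_11_19
    · exact exists_11_20
    · exact exists_11_21
    · exact exists_11_22
    · exact exists_11_23
    · exact exists_11_24
    · exact exists_11_25
    · exact exists_11_26
  · intro k hk
    have hk' : k = 13 ∨ (27 ≤ k ∧ k ≤ 30) := by
      simpa using hk
    rcases hk' with rfl | ⟨h3, h4⟩
    · exact exists_13_13
    · interval_cases k
      · exact exists_13_27
      · exact exists_13_28
      · exact exists_13_29
      · exact exists_13_30
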